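/- arXiv:1705.11046 — 5 statements merged into one kernel-verified Lean document; each statement's English description precedes it below -/
import Mathlib

section
/- Suffix lemma for hash chains of different lengths: Let H : β × γ → β be an injective (collision-free) hash function. If b is a hash chain of length n, b' is a hash chain of length m, and the final blocks agree, b n = b' m, then for every k ≤ min n m, b (n - k) = b' (m - k). -/
/-- Suffix lemma for hash chains of different lengths. -/
theorem hash_chain_suffix {β γ : Type*} (H : β × γ → β)
    (hH : Function.Injective H) (n m : ℕ) (b b' : ℕ → β × γ)
    (hb : ∀ k < n, (b (k + 1)).1 = H (b k))
    (hb' : ∀ k < m, (b' (k + 1)).1 = H (b' k))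
    (hend : b n = b' m) :
    ∀ k ≤ min n m, b (n - k) = b' (m - k) := by
  intro k
  induction k with
  | zero => intro _; simpa using hend
  | succ k ih =>
    intro hk
    have hn : k + 1 ≤ n := le_trans hk (min_le_left _ _)
    have hm : k + 1 ≤ m := le_trans hk (min_le_right _ _)
    have h := ih (by omega)
    have h1 := hb (n - (k + 1)) (by omega)
    have h2 := hb' (m - (k + 1)) (by omega)
    rw [show n - (k + 1) + 1 = n - k by omega] at h1
    rw [show m - (k + 1) + 1 = m - k by omega] at h2
    apply hH
    rw [← h1, ← h2, h]
end

section
/- Consistency of the Pieces (Lemma 2): Let H : β × γ → β be an injective (collision-free) hash function. Suppose b is a hash chain of length n and b' is a hash chain of length m, both begin at the same block, b 0 = b' 0, the starting block satisfies the genesis condition (b 0).1 ∉ Set.range H, and both end at the same block, b n = b' m. Then n = m and b k = b' k for every k ≤ n. In particular there cannot exist two distinct correct pieces that start from the same check point and end at the same check point. -/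
/-- Consistency of the Pieces (Lemma 2): two genesis-rooted correct pieces
with the same start and end blocks coincide. -/
theorem consistency_of_pieces {β γ : Type*} (H : β × γ → β)
    (hH : Function.Injective H) (n m : ℕ) (b b' : ℕ → β × γ)
    (hb : ∀ k < n, (b (k + 1)).1 = H (b k))
    (hb' : ∀ k < m, (b' (k + 1)).1 = H (b' k))
    (hstart : b 0 = b' 0)
    (hgenesis : (b 0).1 ∉ Set.range H)
    (hend : b n = b' m) :
    n = m ∧ ∀ k ≤ n, b k = b' k := by
  induction n generalizing m with
  | zero =>
    cases m with
    | zero =>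
      refine ⟨rfl, fun k hk => ?_⟩
      obtain rfl : k = 0 := by omega
      exact hstart
    | succ m =>
      exact absurd ⟨b' m, by rw [hend, hb' m (Nat.lt_succ_self m)]⟩ hgenesis
  | succ n ih =>
    cases m with
    | zero =>
      exact absurd ⟨b n, by rw [hstart, ← hend, hb n (Nat.lt_succ_self n)]⟩ hgenesis
    | succ m =>
      have h : b n = b' m := hH (by
        rw [← hb n (Nat.lt_succ_self n), ← hb' m (Nat.lt_succ_self m), hend])
      obtain ⟨rfl, h2⟩ := ih m (fun k hk => hb k (by omega)) (fun k hk => hb' k (by omega)) h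
      refine ⟨rfl, fun k hk => ?_⟩
      rcases Nat.lt_or_ge n k with h3 | h3
      · obtain rfl : k = n + 1 := by omega
        exact hend
      · exact h2 k h3
end

section
/- No repeated blocks in a genesis-rooted hash chain (tamper-proof property): Let H : β × γ → β be an injective (collision-free) hash function, and let b be a hash chain of length n whose first block satisfies the genesis condition (b 0).1 ∉ Set.range H. Then the blocks of the chain are pairwise distinct: for all i ≤ n and j ≤ n, if b i = b j then i = j. -/
/-- No repeated blocks in a genesis-rooted hash chain (tamper-proof property). -/
theorem hash_chain_blocks_pairwise_distinct {β γ : Type*} (H : β × γ → β)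
    (hH : Function.Injective H) (n : ℕ) (b : ℕ → β × γ)
    (hb : ∀ k < n, (b (k + 1)).1 = H (b k))
    (hgenesis : (b 0).1 ∉ Set.range H) :
    ∀ i ≤ n, ∀ j ≤ n, b i = b j → i = j := by
  intro i
  induction i with
  | zero =>
    intro _ j hj h
    cases j with
    | zero => rfl
    | succ j => exact absurd ⟨b j, by rw [h, hb j (by omega)]⟩ hgenesis
  | succ i ih =>
    intro hi j hj h
    cases j with
    | zero => exact absurd ⟨b i, by rw [← h, hb i (by omega)]⟩ hgenesis
    | succ j =>
      have h1 : H (b i) = H (b j) := by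
        rw [← hb i (by omega), ← hb j (by omega), h]
      rw [ih (by omega) j (by omega) (hH h1)]
end

section
/- Digests identify positions in a genesis-rooted hash chain: Let H : β × γ → β be an injective (collision-free) hash function, and let b be a hash chain of length n whose first block satisfies the genesis condition (b 0).1 ∉ Set.range H. Then the recorded digest fields along the chain are pairwise distinct: for all i ≤ n and j ≤ n, if (b i).1 = (b j).1 then i = j. -/
/-- Digests identify positions in a genesis-rooted hash chain. -/
theorem hash_chain_digests_pairwise_distinct {β γ : Type*} (H : β × γ → β)
    (hH : Function.Injective H) (n : ℕ) (b : ℕ → β × γ)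
    (hb : ∀ k < n, (b (k + 1)).1 = H (b k))
    (hgenesis : (b 0).1 ∉ Set.range H) :
    ∀ i ≤ n, ∀ j ≤ n, (b i).1 = (b j).1 → i = j := by
  intro i
  induction i with
  | zero =>
    intro _ j hj h
    cases j with
    | zero => rfl
    | succ j => exact absurd ⟨b j, by rw [h, hb j hj]⟩ hgenesis
  | succ i ih =>
    intro hi j hj h
    cases j with
    | zero => exact absurd ⟨b i, by rw [← h, hb i hi]⟩ hgenesis
    | succ j =>
      rw [hb i hi, hb j hj] at h
      rw [ih (Nat.le_of_succ_le hi) j (Nat.le_of_succ_le hj) (congrArg Prod.fst (hH h))]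
end

section
/- Consistency of the Proofs (Theorem 2): Let H : β × γ → β be an injective (collision-free) hash function and let ι be an index set (the nodes whose chains appear in the proofs of a transaction). Suppose for each i : ι we are given a hash chain b i of length n i and a hash chain b' i of length n' i such that both start at the same block, b i 0 = b' i 0, the starting block satisfies the genesis condition (b i 0).1 ∉ Set.range H, and both end at the same block, b i (n i) = b' i (n' i). Then for every i : ι, n i = n' i and b i k = b' i k for every k ≤ n i. In particular, if a correct and complete collection of proofs of a transaction exists, it is unique: no distinct collection of pieces with the same genesis blocks and the same terminal check points can also be correct and complete. -/
theorem chain_aux {β γ : Type*} (H : β × γ → β)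
    (hH : Function.Injective H) (b b' : ℕ → β × γ) (hs : b 0 = b' 0)
    (hg : (b 0).1 ∉ Set.range H) (n : ℕ) :
    ∀ n' : ℕ, (∀ k < n, (b (k + 1)).1 = H (b k)) →
    (∀ k < n', (b' (k + 1)).1 = H (b' k)) → b n = b' n' →
    n = n' ∧ ∀ k ≤ n, b k = b' k := by
  induction n with
  | zero =>
    intro n' _ h2 he
    cases n' with
    | zero =>
      refine ⟨rfl, fun k hk => ?_⟩
      obtain rfl : k = 0 := by omega
      exact hs
    | succ m => exact absurd ⟨b' m, by rw [he, h2 m (by omega)]⟩ hg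
  | succ m ih =>
    intro n' h1 h2 he
    cases n' with
    | zero => exact absurd ⟨b m, by rw [← h1 m (by omega), he, hs]⟩ hg
    | succ m' =>
      have h : b m = b' m' := hH (by
        rw [← h1 m (by omega), ← h2 m' (by omega), he])
      obtain ⟨rfl, h3⟩ := ih m' (fun k hk => h1 k (by omega)) (fun k hk => h2 k (by omega)) h
      refine ⟨rfl, fun k hk => ?_⟩
      rcases Nat.lt_or_ge m k with hk' | hk'
      · obtain rfl : k = m + 1 := by omega
        exact he
      · exact h3 k hk'

/-- Consistency of the Proofs (Theorem 2): a correct and complete family of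
proofs (one genesis-rooted piece per node, with agreeing endpoints) is unique. -/
theorem consistency_of_proofs {β γ ι : Type*} (H : β × γ → β)
    (hH : Function.Injective H) (n n' : ι → ℕ) (b b' : ι → ℕ → β × γ)
    (hb : ∀ i, ∀ k < n i, (b i (k + 1)).1 = H (b i k))
    (hb' : ∀ i, ∀ k < n' i, (b' i (k + 1)).1 = H (b' i k))
    (hstart : ∀ i, b i 0 = b' i 0)
    (hgenesis : ∀ i, (b i 0).1 ∉ Set.range H)
    (hend : ∀ i, b i (n i) = b' i (n' i)) :
    ∀ i, n i = n' i ∧ ∀ k ≤ n i, b i k = b' i k := by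
  intro i
  exact chain_aux H hH (b i) (b' i) (hstart i) (hgenesis i) (n i) (n' i) (hb i) (hb' i) (hend i)
end
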